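/- (Right twist Chamber Ansatz, inverse form, type A.) In the Marsh–Rietsch setup over ℂ with all parameters t_r ≠ 0: the matrix gᵀ·ẇ admits a UDL factorization; set y⃗ := [gᵀẇ]_L^+. Then for every j ∈ {1,…,m}: Δ^{V_j}_{W_j}(y⃗) = ∏_{r ∈ J°, r ≥ j} t_r^{−([q_{j,r}(i_r) ≤ i_j] − [q_{j,r}(i_r+1) ≤ i_j])}, where V_j := (s^v_{i_m}∘s^v_{i_{m−1}}∘···∘s^v_{i_j})({1,…,i_j}), W_j := (s_{i_m}∘s_{i_{m−1}}∘···∘s_{i_j})({1,…,i_j}), and q_{j,r} := s_{i_j}∘s_{i_{j+1}}∘···∘s_{i_{r−1}} (the empty composition, for r = j, being the identity permutation). -/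

import Mathlib

open Matrix Finset

namespace Paper

open scoped Classical

noncomputable section

variable {K : Type*} [Field K] {n m : ℕ}

/-- `N`: upper unitriangular matrices. -/
def IsN (g : Matrix (Fin n) (Fin n) K) : Prop :=
  (∀ i, g i i = 1) ∧ ∀ i j : Fin n, j < i → g i j = 0

/-- `N₋`: lower unitriangular matrices. -/
def IsNm (g : Matrix (Fin n) (Fin n) K) : Prop :=
  (∀ i, g i i = 1) ∧ ∀ i j : Fin n, i < j → g i j = 0

/-- `B`: upper triangular matrices of determinant 1. -/
def IsB (g : Matrix (Fin n) (Fin n) K) : Prop :=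
  g.det = 1 ∧ ∀ i j : Fin n, j < i → g i j = 0

/-- `B₋`: lower triangular matrices of determinant 1. -/
def IsBm (g : Matrix (Fin n) (Fin n) K) : Prop :=
  g.det = 1 ∧ ∀ i j : Fin n, i < j → g i j = 0

/-- `H`: diagonal matrices of determinant 1. -/
def IsH (g : Matrix (Fin n) (Fin n) K) : Prop :=
  g.det = 1 ∧ ∀ i j : Fin n, i ≠ j → g i j = 0

/-- UDL factorization: `g = yp * y0 * ym` with `yp ∈ N`, `y0 ∈ H`, `ym ∈ N₋`. -/
def UDL (g yp y0 ym : Matrix (Fin n) (Fin n) K) : Prop :=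
  IsN yp ∧ IsH y0 ∧ IsNm ym ∧ g = yp * y0 * ym

/-- LDU factorization: `g = zm * z0 * zp` with `zm ∈ N₋`, `z0 ∈ H`, `zp ∈ N`. -/
def LDU (g zm z0 zp : Matrix (Fin n) (Fin n) K) : Prop :=
  IsNm zm ∧ IsH z0 ∧ IsN zp ∧ g = zm * z0 * zp

/-- The signed permutation matrix `v̇`. -/
def pdot (v : Equiv.Perm (Fin n)) : Matrix (Fin n) (Fin n) K :=
  Matrix.of fun a b : Fin n =>
    if a = v b then
      (-1 : K) ^ (univ.filter fun k : Fin n => b < k ∧ v k < v b).card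
    else 0

/-- Membership in the double coset `B₋ w B₋`. -/
def InBmWBm (w : Equiv.Perm (Fin n)) (g : Matrix (Fin n) (Fin n) K) : Prop :=
  ∃ b₁ b₂ : Matrix (Fin n) (Fin n) K, IsBm b₁ ∧ IsBm b₂ ∧ g = b₁ * pdot w * b₂

/-- `Δ^I_J(g)`: the minor with row set `I` and column set `J` (junk value 0 if sizes differ). -/
def minor (g : Matrix (Fin n) (Fin n) K) (I J : Finset (Fin n)) : K :=
  if h : I.card = J.card then
    Matrix.det (Matrix.of fun a b : Fin I.card =>
      g (I.orderEmbOfFin rfl a) (J.orderEmbOfFin h.symm b))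
  else 0

/-- All right-aligned flag minors of `g` are nonnegative. -/
def RightFlagNonneg (g : Matrix (Fin n) (Fin n) ℝ) : Prop :=
  ∀ I : Finset (Fin n),
    0 ≤ minor g I (univ.filter fun j : Fin n => n - I.card ≤ (j : ℕ))

/-- All top-aligned flag minors of `g` are nonnegative. -/
def TopFlagNonneg (g : Matrix (Fin n) (Fin n) ℝ) : Prop :=
  ∀ J : Finset (Fin n),
    0 ≤ minor g (univ.filter fun i : Fin n => (i : ℕ) < J.card) J

/-- `x_i(t)` (with 1-based `i`): `Id + t·E_{i,i+1}`. -/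
def xmat (i : ℕ) (t : K) : Matrix (Fin n) (Fin n) K :=
  Matrix.of fun a b : Fin n =>
    if a = b then 1 else if (a : ℕ) + 1 = i ∧ (b : ℕ) = i then t else 0

/-- `y_i(t)` (with 1-based `i`): `Id + t·E_{i+1,i}`. -/
def ymat (i : ℕ) (t : K) : Matrix (Fin n) (Fin n) K :=
  Matrix.of fun a b : Fin n =>
    if a = b then 1 else if (a : ℕ) = i ∧ (b : ℕ) + 1 = i then t else 0

/-- `ṡ_i` (with 1-based `i`). -/
def sdot (i : ℕ) : Matrix (Fin n) (Fin n) K :=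
  Matrix.of fun a b : Fin n =>
    if (a : ℕ) + 1 = i ∧ (b : ℕ) = i then 1
    else if (a : ℕ) = i ∧ (b : ℕ) + 1 = i then -1
    else if a = b ∧ (a : ℕ) + 1 ≠ i ∧ (a : ℕ) ≠ i then 1
    else 0

/-- The adjacent transposition `s_i` (with 1-based `i`); identity if out of range. -/
def sperm (n : ℕ) (i : ℕ) : Equiv.Perm (Fin n) :=
  if h : i < n then
    Equiv.swap ⟨i - 1, Nat.lt_of_le_of_lt (Nat.sub_le i 1) h⟩ ⟨i, h⟩
  else 1

/-- `ℓ(w)`: the number of inversions of `w`. -/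
def len (w : Equiv.Perm (Fin n)) : ℕ :=
  (univ.filter fun p : Fin n × Fin n => p.1 < p.2 ∧ w p.2 < w p.1).card

/-- `vseq ii v k = v_{(m-k)}`: the rightmost (positive distinguished) subexpression recursion. -/
def vseq (ii : Fin m → ℕ) (v : Equiv.Perm (Fin n)) : ℕ → Equiv.Perm (Fin n)
  | 0 => v
  | k + 1 =>
    if h : m - k - 1 < m then
      if len (vseq ii v k * sperm n (ii ⟨m - k - 1, h⟩)) < len (vseq ii v k) then
        vseq ii v k * sperm n (ii ⟨m - k - 1, h⟩)
      else vseq ii v k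
    else vseq ii v k

/-- `r ∈ J°` (0-based `r`, corresponding to the 1-based index `r+1`). -/
def inJ (ii : Fin m → ℕ) (v : Equiv.Perm (Fin n)) (r : Fin m) : Prop :=
  vseq ii v (m - (r : ℕ)) = vseq ii v (m - (r : ℕ) - 1)

/-- The list `[s_{i_1}, …, s_{i_m}]` of adjacent transpositions. -/
def sPermList (n : ℕ) (ii : Fin m → ℕ) : List (Equiv.Perm (Fin n)) :=
  List.ofFn fun r => sperm n (ii r)

/-- The list `[s^v_{i_1}, …, s^v_{i_m}]`. -/
def svPermList (ii : Fin m → ℕ) (v : Equiv.Perm (Fin n)) : List (Equiv.Perm (Fin n)) :=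
  List.ofFn fun r => if inJ ii v r then 1 else sperm n (ii r)

/-- The factors `g_1, …, g_m` of the Marsh–Rietsch element. -/
def mrgList (ii : Fin m → ℕ) (v : Equiv.Perm (Fin n)) (t : Fin m → K) :
    List (Matrix (Fin n) (Fin n) K) :=
  List.ofFn fun r => if inJ ii v r then xmat (ii r) (t r) else sdot (ii r)

/-- The Marsh–Rietsch element `g = g_1 ⋯ g_m`. -/
def mrg (ii : Fin m → ℕ) (v : Equiv.Perm (Fin n)) (t : Fin m → K) :
    Matrix (Fin n) (Fin n) K :=
  (mrgList ii v t).prod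

/-- The list `[ṡ_{i_1}, …, ṡ_{i_m}]`. -/
def sdotList (n : ℕ) (ii : Fin m → ℕ) : List (Matrix (Fin n) (Fin n) K) :=
  List.ofFn fun r => sdot (ii r)

/-- `ẇ = ṡ_{i_1} ⋯ ṡ_{i_m}`. -/
def wMR (n : ℕ) (ii : Fin m → ℕ) : Matrix (Fin n) (Fin n) K :=
  (sdotList n ii).prod

/-! ## Lengths -/

theorem len_mul_le (a b : Equiv.Perm (Fin n)) : len (a * b) ≤ len a + len b := by
  unfold len
  have : (univ.filter fun p : Fin n × Fin n => p.1 < p.2 ∧ (a * b) p.2 < (a * b) p.1) ⊆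
      ((univ.filter fun p : Fin n × Fin n => p.1 < p.2 ∧ a p.2 < a p.1).image
        fun p => (b⁻¹ p.1, b⁻¹ p.2)) ∪
      (univ.filter fun p : Fin n × Fin n => p.1 < p.2 ∧ b p.2 < b p.1) := by
    rintro ⟨p, q⟩ h
    simp only [mem_filter, mem_univ, true_and, mem_union, mem_image] at h ⊢
    simp only [Equiv.Perm.mul_apply] at h
    rcases lt_trichotomy (b p) (b q) with h1 | h1 | h1
    · left
      exact ⟨(b p, b q), ⟨h1, h.2⟩, by simp⟩
    · exact absurd (b.injective h1) h.1.ne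
    · right; exact ⟨h.1, h1⟩
  refine (card_le_card this).trans ((card_union_le _ _).trans ?_)
  exact Nat.add_le_add_right card_image_le _

theorem swap_lt {i₀ i₁ p q : Fin n} (hi : (i₁ : ℕ) = i₀ + 1) (hpq : p < q)
    (h : Equiv.swap i₀ i₁ q < Equiv.swap i₀ i₁ p) : p = i₀ ∧ q = i₁ := by
  rw [Fin.lt_def] at hpq h
  simp only [Equiv.swap_apply_def] at h
  simp only [Fin.ext_iff] at h ⊢
  split_ifs at h <;> omega

theorem len_swap_le {i₀ i₁ : Fin n} (hi : (i₁ : ℕ) = i₀ + 1) : len (Equiv.swap i₀ i₁) ≤ 1 := by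
  unfold len
  refine (card_le_card (t := {(i₀, i₁)}) ?_).trans (by simp)
  rintro ⟨p, q⟩ h
  simp only [mem_filter, mem_univ, true_and] at h
  obtain ⟨rfl, rfl⟩ := swap_lt hi h.1 h.2
  simp

theorem len_mul_swap_lt {i₀ i₁ : Fin n} (hi : (i₁ : ℕ) = i₀ + 1) (w : Equiv.Perm (Fin n))
    (h : w i₁ < w i₀) : len (w * Equiv.swap i₀ i₁) < len w := by
  unfold len
  have hlt : i₀ < i₁ := by rw [Fin.lt_def]; omega
  set s := Equiv.swap i₀ i₁ with hs
  have h2 : ((univ.filter fun p : Fin n × Fin n => p.1 < p.2 ∧ (w * s) p.2 < (w * s) p.1).image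
      fun p => (s p.1, s p.2)) ⊂
      (univ.filter fun p : Fin n × Fin n => p.1 < p.2 ∧ w p.2 < w p.1) := by
    rw [Finset.ssubset_iff_of_subset]
    · refine ⟨(i₀, i₁), by simp [h, hlt], ?_⟩
      simp only [mem_image, mem_filter, mem_univ, true_and, Prod.exists, not_exists, not_and,
        Prod.mk.injEq]
      rintro p q ⟨h1, -⟩ hp hq
      have e1 : p = i₁ := by rw [← s.injective.eq_iff, hp, hs]; simp
      have e2 : q = i₀ := by rw [← s.injective.eq_iff, hq, hs]; simp
      subst e1 e2
      exact absurd h1 hlt.asymm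
    · rintro ⟨p', q'⟩ hx
      simp only [mem_image, mem_filter, mem_univ, true_and, Prod.exists,
        Prod.mk.injEq] at hx ⊢
      obtain ⟨p, q, ⟨h1, h3⟩, rfl, rfl⟩ := hx
      simp only [Equiv.Perm.mul_apply] at h3
      refine ⟨?_, h3⟩
      rcases lt_trichotomy (s p) (s q) with h4 | h4 | h4
      · exact h4
      · exact absurd (s.injective h4) h1.ne
      · obtain ⟨rfl, rfl⟩ := swap_lt hi h1 h4
        rw [hs] at h3
        simp only [Equiv.swap_apply_left, Equiv.swap_apply_right] at h3
        exact absurd h3 h.asymm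
  have := card_lt_card h2
  rwa [card_image_of_injective] at this
  intro x y hxy
  simpa [Prod.ext_iff] using hxy

/-! ## Minors -/

theorem minor_eq (g : Matrix (Fin n) (Fin n) K) {I J : Finset (Fin n)} {k : ℕ}
    (hI : I.card = k) (hJ : J.card = k) :
    minor g I J = Matrix.det (Matrix.of fun a b : Fin k =>
      g (I.orderEmbOfFin hI a) (J.orderEmbOfFin hJ b)) := by
  subst hI
  unfold minor
  rw [dif_pos hJ.symm]

theorem minor_transpose (g : Matrix (Fin n) (Fin n) K) (I J : Finset (Fin n)) :
    minor gᵀ I J = minor g J I := by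
  by_cases h : I.card = J.card
  · rw [minor_eq gᵀ rfl h.symm, minor_eq g h.symm rfl, ← det_transpose]
    rfl
  · unfold minor
    rw [dif_neg h, dif_neg (Ne.symm h)]

theorem minor_congr {g g' : Matrix (Fin n) (Fin n) K} {I J : Finset (Fin n)}
    (h : ∀ p ∈ I, ∀ q, g p q = g' p q) : minor g I J = minor g' I J := by
  unfold minor
  split_ifs with hc
  · congr 1
    ext a b
    exact h _ (orderEmbOfFin_mem _ _ _) _
  · rfl

theorem transvection_mul_apply (a b : Fin n) (t : K) (M : Matrix (Fin n) (Fin n) K)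
    (p q : Fin n) : (transvection a b t * M) p q = M p q + if p = a then t * M b q else 0 := by
  split_ifs with h
  · subst h; simp
  · simp [h]

theorem mul_transvection_apply (a b : Fin n) (t : K) (M : Matrix (Fin n) (Fin n) K)
    (p q : Fin n) : (M * transvection a b t) p q = M p q + if q = b then t * M p a else 0 := by
  split_ifs with h
  · subst h; simp
  · simp [h]

theorem minor_transvection_mul {a b : Fin n} (hab : a ≠ b) (t : K)
    (M : Matrix (Fin n) (Fin n) K) {I : Finset (Fin n)} (J : Finset (Fin n))
    (h : a ∈ I → b ∈ I) : minor (transvection a b t * M) I J = minor M I J := by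
  by_cases ha : a ∈ I
  · by_cases hc : I.card = J.card
    · rw [minor_eq _ rfl hc.symm, minor_eq _ rfl hc.symm]
      have ha' : a ∈ Set.range (I.orderEmbOfFin rfl) := by simpa using ha
      have hb' : b ∈ Set.range (I.orderEmbOfFin rfl) := by simpa using h ha
      obtain ⟨x, hx⟩ := ha'
      obtain ⟨y, hy⟩ := hb'
      have hxy : x ≠ y := by rintro rfl; exact hab (hx.symm.trans hy)
      rw [← det_updateRow_add_smul_self (Matrix.of fun a b : Fin I.card =>
        M (I.orderEmbOfFin rfl a) (J.orderEmbOfFin hc.symm b)) hxy t]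
      congr 1
      ext p q
      by_cases hp : p = x
      · subst hp
        simp [transvection_mul_apply, hx, hy]
      · have : I.orderEmbOfFin rfl p ≠ a := by
          rw [← hx]; simpa using hp
        simp [transvection_mul_apply, this, hp]
    · unfold minor
      rw [dif_neg hc, dif_neg hc]
  · apply minor_congr
    intro p hp q
    rw [transvection_mul_apply, if_neg (by rintro rfl; exact ha hp), add_zero]

theorem minor_mul_diagonal (M : Matrix (Fin n) (Fin n) K) (d : Fin n → K)
    (I J : Finset (Fin n)) :
    minor (M * diagonal d) I J = (∏ x ∈ J, d x) * minor M I J := by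
  by_cases hc : I.card = J.card
  · rw [minor_eq _ rfl hc.symm, minor_eq _ rfl hc.symm]
    have : ∏ x ∈ J, d x = ∏ x, d (J.orderEmbOfFin hc.symm x) := by
      conv_lhs => rw [← image_orderEmbOfFin_univ J hc.symm]
      rw [prod_image]
      intro x _ y _ hxy
      simpa using hxy
    rw [this, ← det_mul_row]
    congr 1
    ext a b
    simp [mul_comm]
  · unfold minor
    rw [dif_neg hc, dif_neg hc, mul_zero]

theorem minor_self_of_isN {a : Matrix (Fin n) (Fin n) K} (ha : IsN a) (I : Finset (Fin n)) :
    minor a I I = 1 := by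
  rw [minor_eq a rfl rfl, det_of_isUpperTriangular]
  · simp [ha.1]
  · intro x y hxy
    exact ha.2 _ _ (by simpa using hxy)

/-! ## The one-step lemma -/

variable (K) in
/-- Signed simple transposition. -/
def SS (i₀ i₁ : Fin n) : Matrix (Fin n) (Fin n) K :=
  Matrix.of fun p q => if p = Equiv.swap i₀ i₁ q then (if q = i₀ then -1 else 1) else 0

/-- Coroot diagonal vector. -/
def dd (i₀ i₁ : Fin n) (t : K) : Fin n → K :=
  fun p => if p = i₀ then t else if p = i₁ then t⁻¹ else 1

theorem mul_SS_apply (i₀ i₁ : Fin n) (M : Matrix (Fin n) (Fin n) K) (p q : Fin n) :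
    (M * SS K i₀ i₁) p q = (if q = i₀ then -1 else 1) * M p (Equiv.swap i₀ i₁ q) := by
  simp only [Matrix.mul_apply, SS, Matrix.of_apply, mul_ite, mul_zero]
  rw [Finset.sum_ite_eq']
  simp [mul_comm]

theorem SST_mul_apply (i₀ i₁ : Fin n) (M : Matrix (Fin n) (Fin n) K) (p q : Fin n) :
    ((SS K i₀ i₁)ᵀ * M) p q = (if p = i₀ then -1 else 1) * M (Equiv.swap i₀ i₁ p) q := by
  have : (SS K i₀ i₁)ᵀ * M = (Mᵀ * SS K i₀ i₁)ᵀ := by simp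
  rw [this, transpose_apply, mul_SS_apply, transpose_apply]

theorem SS_mul_SST {i₀ i₁ : Fin n} : (SS K i₀ i₁ : Matrix _ _ K) * (SS K i₀ i₁)ᵀ = 1 := by
  rw [mul_eq_one_comm]
  ext p q
  rw [SST_mul_apply]
  simp only [SS, Matrix.of_apply, one_apply, Equiv.apply_eq_iff_eq]
  split_ifs <;> simp_all

theorem SST_eq {i₀ i₁ : Fin n} (h : i₀ ≠ i₁) : ((SS K i₀ i₁)ᵀ : Matrix _ _ K) =
    transvection i₀ i₁ (-1) * (transvection i₁ i₀ 1 * transvection i₀ i₁ (-1)) := by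
  have h' := h.symm
  ext p q
  rw [transvection_mul_apply, transvection_mul_apply, transvection_mul_apply, ← mul_one (SS K i₀ i₁)ᵀ,
    SST_mul_apply]
  simp only [transvection, Matrix.add_apply, Matrix.single_apply, Matrix.one_apply, Equiv.swap_apply_def]
  grind

theorem minor_SST_mul {i₀ i₁ : Fin n} (hi : (i₁ : ℕ) = i₀ + 1) (M : Matrix (Fin n) (Fin n) K)
    {I : Finset (Fin n)} (J : Finset (Fin n)) (h : i₁ ∈ I → i₀ ∈ I) :
    minor ((SS K i₀ i₁)ᵀ * M) (I.image (Equiv.swap i₀ i₁)) J = minor M I J := by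
  have hne : i₀ ≠ i₁ := by rintro rfl; omega
  by_cases h0 : i₀ ∈ I
  · by_cases h1 : i₁ ∈ I
    · have : I.image (Equiv.swap i₀ i₁) = I := by
        ext x
        simp only [mem_image]
        constructor
        · rintro ⟨y, hy, rfl⟩
          rw [Equiv.swap_apply_def]; split_ifs <;> assumption
        · intro hx
          refine ⟨Equiv.swap i₀ i₁ x, ?_, by simp⟩
          rw [Equiv.swap_apply_def]; split_ifs <;> assumption
      rw [this, SST_eq hne, mul_assoc, mul_assoc,
        minor_transvection_mul hne _ _ _ (fun _ => h1),
        minor_transvection_mul hne.symm _ _ _ (fun _ => h0),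
        minor_transvection_mul hne _ _ _ (fun _ => h1)]
    · have hc : (I.image (Equiv.swap i₀ i₁)).card = I.card :=
        card_image_of_injective _ (Equiv.injective _)
      by_cases hJ : I.card = J.card
      · rw [minor_eq _ hc hJ.symm, minor_eq _ rfl hJ.symm]
        have key := orderEmbOfFin_unique hc
          (f := fun x => Equiv.swap i₀ i₁ (I.orderEmbOfFin rfl x))
          (fun x => mem_image_of_mem _ (orderEmbOfFin_mem _ _ _)) (by
            intro x y hxy
            have h2 : I.orderEmbOfFin rfl x < I.orderEmbOfFin rfl y := by simpa using hxy
            rcases lt_trichotomy (Equiv.swap i₀ i₁ (I.orderEmbOfFin rfl x))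
              (Equiv.swap i₀ i₁ (I.orderEmbOfFin rfl y)) with h4 | h4 | h4
            · exact h4
            · exact absurd (Equiv.injective _ h4) h2.ne
            · have := (swap_lt hi h2 h4).2
              exact absurd (this ▸ orderEmbOfFin_mem I rfl y) h1)
        congr 1
        ext a b
        rw [Matrix.of_apply, Matrix.of_apply, ← key, SST_mul_apply, Equiv.swap_apply_self, if_neg,
          one_mul]
        intro h3
        apply h1
        have : I.orderEmbOfFin rfl a = i₁ := by
          rw [← (Equiv.swap i₀ i₁).injective.eq_iff]; simpa using h3
        exact this ▸ orderEmbOfFin_mem I rfl a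
      · unfold minor
        rw [dif_neg hJ, dif_neg (by rwa [hc])]
  · have h1 : i₁ ∉ I := fun h' => h0 (h h')
    have e : ∀ x ∈ I, Equiv.swap i₀ i₁ x = x := fun x hx =>
      Equiv.swap_apply_of_ne_of_ne (by rintro rfl; exact h0 hx) (by rintro rfl; exact h1 hx)
    have : I.image (Equiv.swap i₀ i₁) = I := by
      conv_rhs => rw [← image_id (s := I)]
      exact image_congr e
    rw [this]
    apply minor_congr
    intro p hp q
    rw [SST_mul_apply, e p hp, if_neg (by rintro rfl; exact h0 hp), one_mul]

theorem minor_mul_SS {i₀ i₁ : Fin n} (hi : (i₁ : ℕ) = i₀ + 1) (M : Matrix (Fin n) (Fin n) K)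
    (I : Finset (Fin n)) {J : Finset (Fin n)} (h : i₁ ∈ J → i₀ ∈ J) :
    minor (M * SS K i₀ i₁) I (J.image (Equiv.swap i₀ i₁)) = minor M I J := by
  rw [← minor_transpose, transpose_mul, minor_SST_mul hi _ _ h, minor_transpose]

theorem transvection_transpose (a b : Fin n) (t : K) :
    (transvection a b t)ᵀ = transvection b a t := by
  simp [transvection]

theorem minor_mul_transvection {a b : Fin n} (hab : a ≠ b) (t : K)
    (M : Matrix (Fin n) (Fin n) K) (I : Finset (Fin n)) {J : Finset (Fin n)}
    (h : b ∈ J → a ∈ J) : minor (M * transvection a b t) I J = minor M I J := by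
  rw [← minor_transpose, transpose_mul, transvection_transpose,
    minor_transvection_mul hab.symm _ _ _ h, minor_transpose]

theorem IsN.mul {a b : Matrix (Fin n) (Fin n) K} (ha : IsN a) (hb : IsN b) : IsN (a * b) := by
  have key : ∀ p q k : Fin n, q ≤ p → (k ≠ p ∨ q ≠ p) → a p k * b k q = 0 := by
    intro p q k hqp hk
    rcases lt_or_ge k p with h | h
    · rw [ha.2 _ _ h, zero_mul]
    · rw [hb.2 k q, mul_zero]
      rcases hk with h' | h'
      · exact lt_of_le_of_lt hqp (lt_of_le_of_ne h h'.symm)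
      · exact lt_of_lt_of_le (lt_of_le_of_ne hqp h') h
  constructor
  · intro p
    rw [Matrix.mul_apply, Finset.sum_eq_single p]
    · simp [ha.1, hb.1]
    · intro k _ hk
      exact key p p k le_rfl (Or.inl hk)
    · simp
  · intro p q hpq
    rw [Matrix.mul_apply]
    exact Finset.sum_eq_zero fun k _ => key p q k hpq.le (Or.inr hpq.ne)

theorem isN_transvection {a b : Fin n} (hab : a < b) (t : K) : IsN (transvection a b t) := by
  constructor
  · intro i
    have : ¬ (a = i ∧ b = i) := by rintro ⟨rfl, rfl⟩; exact lt_irrefl _ hab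
    simp [transvection, this]
  · intro i j hij
    have : ¬ (a = i ∧ b = j) := by rintro ⟨rfl, rfl⟩; exact absurd hab hij.asymm
    simp [transvection, this, one_apply, hij.ne']

/-- Invariant for the lower triangular part. -/
def LowInv (w : Equiv.Perm (Fin n)) (L : Matrix (Fin n) (Fin n) K) : Prop :=
  ∀ p q, L p q ≠ 0 → q ≤ p ∧ w p ≤ w q

theorem lowInv_step {i₀ i₁ : Fin n} (hi : (i₁ : ℕ) = i₀ + 1) {w : Equiv.Perm (Fin n)}
    (hw : w i₀ < w i₁) {L : Matrix (Fin n) (Fin n) K} (hL : LowInv w L) (c : K)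
    (d : Fin n → K) :
    LowInv (w * Equiv.swap i₀ i₁)
      (diagonal d * ((SS K i₀ i₁)ᵀ * (transvection i₀ i₁ c * L)) * SS K i₀ i₁) := by
  intro p q h
  have hlt : i₀ < i₁ := by rw [Fin.lt_def]; omega
  rw [mul_SS_apply, diagonal_mul, SST_mul_apply] at h
  replace h := right_ne_zero_of_mul (right_ne_zero_of_mul (right_ne_zero_of_mul h))
  simp only [Equiv.Perm.mul_apply]
  set s := Equiv.swap i₀ i₁ with hs
  rw [transvection_mul_apply] at h
  have h2 : (s q ≤ s p ∧ w (s p) ≤ w (s q)) ∨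
      (s p = i₀ ∧ s q ≤ i₁ ∧ w i₁ ≤ w (s q)) := by
    by_cases h3 : L (s p) (s q) = 0
    · rw [h3, zero_add] at h
      split_ifs at h with h4
      · right
        exact ⟨h4, hL _ _ (right_ne_zero_of_mul h)⟩
      · exact absurd rfl h
    · left; exact hL _ _ h3
  have hss : ∀ x, s (s x) = x := by intro x; simp [hs]
  have hle : w (s p) ≤ w (s q) := by
    rcases h2 with h2 | h2
    · exact h2.2
    · rw [h2.1]; exact hw.le.trans h2.2.2
  refine ⟨?_, hle⟩
  by_contra hqp
  push Not at hqp
  by_cases h4 : s q < s p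
  · obtain ⟨rfl, rfl⟩ := swap_lt hi hqp h4
    rw [hs] at hle
    simp only [Equiv.swap_apply_left, Equiv.swap_apply_right] at hle
    exact absurd hw (not_lt.2 hle)
  · rcases h2 with h2 | h2
    · have := le_antisymm h2.1 (not_lt.1 h4)
      exact hqp.ne (s.injective this.symm)
    · have hp : p = i₁ := by rw [← hss p, h2.1, hs]; simp
      rcases eq_or_lt_of_le h2.2.1 with h5 | h5
      · have hq : q = i₀ := by rw [← hss q, h5, hs]; simp
        rw [hp, hq] at hqp
        exact absurd hqp hlt.asymm
      · have h6 : s q = i₀ := by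
          apply le_antisymm
          · rw [Fin.le_def]; rw [Fin.lt_def] at h5; omega
          · rw [← h2.1]; exact not_lt.1 h4
        rw [h6] at h2
        exact absurd hw (not_lt.2 h2.2.2)

theorem isN_kill {i₀ i₁ : Fin n} (hlt : i₀ < i₁) {a : Matrix (Fin n) (Fin n) K}
    (ha : IsN a) : IsN (a * transvection i₀ i₁ (-a i₀ i₁)) ∧
      (a * transvection i₀ i₁ (-a i₀ i₁)) i₀ i₁ = 0 := by
  refine ⟨ha.mul (isN_transvection hlt _), ?_⟩
  rw [mul_transvection_apply, if_pos rfl, ha.1]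
  ring

theorem isN_conj_SS {i₀ i₁ : Fin n} (hi : (i₁ : ℕ) = i₀ + 1) {a : Matrix (Fin n) (Fin n) K}
    (ha : IsN a) (h0 : a i₀ i₁ = 0) : IsN ((SS K i₀ i₁)ᵀ * a * SS K i₀ i₁) := by
  constructor
  · intro p
    rw [mul_SS_apply, SST_mul_apply, ha.1]
    split_ifs <;> ring
  · intro p q hqp
    rw [mul_SS_apply, SST_mul_apply]
    rcases lt_trichotomy (Equiv.swap i₀ i₁ p) (Equiv.swap i₀ i₁ q) with h | h | h
    · obtain ⟨rfl, rfl⟩ := swap_lt hi hqp h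
      simp [h0]
    · exact absurd (Equiv.injective _ h) hqp.ne'
    · rw [ha.2 _ _ h]; ring

theorem isN_conj_Y {i₀ i₁ : Fin n} (hi : (i₁ : ℕ) = i₀ + 1) {a : Matrix (Fin n) (Fin n) K}
    (ha : IsN a) (h0 : a i₀ i₁ = 0) (t : K) :
    IsN (transvection i₁ i₀ t * a * transvection i₁ i₀ (-t)) := by
  have hlt : i₀ < i₁ := by rw [Fin.lt_def]; omega
  constructor
  · intro p
    rw [mul_transvection_apply, transvection_mul_apply, transvection_mul_apply, ha.1]
    by_cases h1 : p = i₀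
    · subst h1; simp [h0, hlt.ne]
    · by_cases h2 : p = i₁
      · subst h2; simp [h0, h1]
      · simp [h1, h2]
  · intro p q hqp
    rw [mul_transvection_apply, transvection_mul_apply, transvection_mul_apply, ha.2 _ _ hqp]
    by_cases h1 : p = i₁
    · subst h1
      by_cases h2 : q = i₀
      · subst h2; simp [ha.1, h0]
      · have : q < i₀ := by
          rw [Fin.lt_def] at hqp ⊢
          rw [Fin.ext_iff] at h2
          omega
        simp [h2, ha.2 _ _ this]
    · by_cases h2 : q = i₀
      · subst h2
        have : i₁ < p := by
          rw [Fin.lt_def] at hqp ⊢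
          rw [Fin.ext_iff] at h1
          omega
        simp [h1, ha.2 _ _ this]
      · simp [h1, h2]

theorem XSD_eq {i₀ i₁ : Fin n} (h : i₀ ≠ i₁) {t : K} (ht : t ≠ 0) :
    transvection i₀ i₁ (-t⁻¹) * SS K i₀ i₁ * diagonal (dd i₀ i₁ t) =
      transvection i₁ i₀ (-t) * transvection i₀ i₁ t⁻¹ := by
  have h' := h.symm
  ext p q
  rw [mul_diagonal, mul_SS_apply, transvection_mul_apply]
  simp only [transvection, Matrix.add_apply, Matrix.single_apply, Matrix.one_apply, Equiv.swap_apply_def, dd]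
  grind

theorem step_S {i₀ i₁ : Fin n} (hi : (i₁ : ℕ) = i₀ + 1) {w : Equiv.Perm (Fin n)}
    (hw : w i₀ < w i₁) {a L : Matrix (Fin n) (Fin n) K} (ha : IsN a) (hL : LowInv w L) :
    ∃ a' L', (SS K i₀ i₁)ᵀ * (a * L) * SS K i₀ i₁ = a' * L' ∧ IsN a' ∧
      LowInv (w * Equiv.swap i₀ i₁) L' ∧
      ∀ I J : Finset (Fin n), (i₁ ∈ I → i₀ ∈ I) → (i₁ ∈ J → i₀ ∈ J) →
        minor a' (I.image (Equiv.swap i₀ i₁)) (J.image (Equiv.swap i₀ i₁)) = minor a I J := by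
  have hlt : i₀ < i₁ := by rw [Fin.lt_def]; omega
  obtain ⟨h1, h2⟩ := isN_kill hlt ha
  set c := a i₀ i₁
  have hX : transvection i₀ i₁ (-c) * transvection i₀ i₁ c = 1 := by
    rw [transvection_mul_transvection_same _ _ hlt.ne]; simp
  refine ⟨(SS K i₀ i₁)ᵀ * (a * transvection i₀ i₁ (-c)) * SS K i₀ i₁,
    diagonal 1 * ((SS K i₀ i₁)ᵀ * (transvection i₀ i₁ c * L)) * SS K i₀ i₁, ?_,
    isN_conj_SS hi h1 h2, lowInv_step hi hw hL _ _, ?_⟩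
  · have e1 : (diagonal 1 : Matrix (Fin n) (Fin n) K) = 1 := diagonal_one
    rw [e1, one_mul]
    calc _ = (SS K i₀ i₁)ᵀ * (a * 1 * L) * SS K i₀ i₁ := by rw [mul_one]
      _ = (SS K i₀ i₁)ᵀ * (a * (transvection i₀ i₁ (-c) * 1 * transvection i₀ i₁ c) * L)
          * SS K i₀ i₁ := by rw [mul_one (transvection i₀ i₁ (-c)), hX]
      _ = _ := by rw [← SS_mul_SST (i₀ := i₀) (i₁ := i₁)]; simp only [mul_assoc]
  · intro I J hI hJ
    rw [minor_mul_SS hi _ _ hJ, minor_SST_mul hi _ _ hI, minor_mul_transvection hlt.ne _ _ _ hJ]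

theorem step_X {i₀ i₁ : Fin n} (hi : (i₁ : ℕ) = i₀ + 1) {w : Equiv.Perm (Fin n)}
    (hw : w i₀ < w i₁) {a L : Matrix (Fin n) (Fin n) K} (ha : IsN a) (hL : LowInv w L)
    {t : K} (ht : t ≠ 0) :
    ∃ a' L', transvection i₁ i₀ t * (a * L) * SS K i₀ i₁ = a' * L' ∧ IsN a' ∧
      LowInv (w * Equiv.swap i₀ i₁) L' ∧
      ∀ I J : Finset (Fin n), (i₁ ∈ I → i₀ ∈ I) → (i₁ ∈ J → i₀ ∈ J) →
        minor a' I (J.image (Equiv.swap i₀ i₁)) =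
          t ^ (-((if i₀ ∈ J then (1 : ℤ) else 0) - (if i₁ ∈ J then (1 : ℤ) else 0)))
            * minor a I J := by
  have hlt : i₀ < i₁ := by rw [Fin.lt_def]; omega
  obtain ⟨h1, h2⟩ := isN_kill hlt ha
  set c := a i₀ i₁
  have hX : transvection i₀ i₁ (-c + -t⁻¹) * transvection i₀ i₁ (c + t⁻¹) = 1 := by
    rw [transvection_mul_transvection_same _ _ hlt.ne,
      show -c + -t⁻¹ + (c + t⁻¹) = 0 by ring, transvection_zero]
  have hD : diagonal (dd i₀ i₁ t) * diagonal (dd i₀ i₁ t⁻¹) = 1 := by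
    rw [diagonal_mul_diagonal, ← diagonal_one]
    congr 1
    ext p
    simp only [dd]
    split_ifs <;> simp [ht]
  have hA : transvection i₁ i₀ t * (a * transvection i₀ i₁ (-c + -t⁻¹)) * SS K i₀ i₁ *
      diagonal (dd i₀ i₁ t) = transvection i₁ i₀ t * (a * transvection i₀ i₁ (-c)) *
        transvection i₁ i₀ (-t) * transvection i₀ i₁ t⁻¹ := by
    rw [← transvection_mul_transvection_same _ _ hlt.ne, mul_assoc _ (transvection i₁ i₀ (-t)),
      ← XSD_eq hlt.ne ht]
    simp only [mul_assoc]
  refine ⟨transvection i₁ i₀ t * (a * transvection i₀ i₁ (-c + -t⁻¹)) * SS K i₀ i₁ *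
      diagonal (dd i₀ i₁ t),
    diagonal (dd i₀ i₁ t⁻¹) * ((SS K i₀ i₁)ᵀ * (transvection i₀ i₁ (c + t⁻¹) * L)) * SS K i₀ i₁, ?_,
    ?_, lowInv_step hi hw hL _ _, ?_⟩
  · calc _ = transvection i₁ i₀ t * (a * 1 * L) * SS K i₀ i₁ := by rw [mul_one]
      _ = transvection i₁ i₀ t * (a * (transvection i₀ i₁ (-c + -t⁻¹) * (SS K i₀ i₁ * 1 *
          (SS K i₀ i₁)ᵀ) * transvection i₀ i₁ (c + t⁻¹)) * L)
          * SS K i₀ i₁ := by rw [mul_one (SS K i₀ i₁), SS_mul_SST,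
            mul_one (transvection i₀ i₁ (-c + -t⁻¹)), hX]
      _ = _ := by rw [← hD]; simp only [mul_assoc]
  · rw [hA]
    exact (isN_conj_Y hi h1 h2 t).mul (isN_transvection hlt _)
  · intro I J hI hJ
    rw [minor_mul_diagonal, minor_mul_SS hi _ _ hJ, minor_transvection_mul hlt.ne' _ _ _ hI,
      minor_mul_transvection hlt.ne _ _ _ hJ]
    congr 1
    rw [prod_image (fun x _ y _ h => Equiv.injective _ h)]
    have e : ∀ x, dd i₀ i₁ t (Equiv.swap i₀ i₁ x) =
        (if x = i₁ then t else 1) * (if x = i₀ then t⁻¹ else 1) := by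
      intro x
      simp only [dd, Equiv.swap_apply_def]
      by_cases hx0 : x = i₀
      · subst hx0; simp [hlt.ne, hlt.ne']
      · by_cases hx1 : x = i₁
        · subst hx1; simp [hlt.ne']
        · simp [hx0, hx1]
    simp only [e]
    rw [prod_mul_distrib, prod_ite_eq', prod_ite_eq']
    split_ifs <;> simp [ht]

/-! ## Assembly -/

theorem seg_succ {M : Type*} [Monoid M] (l : List M) {j r : ℕ} (hj : j ≤ r) (hr : r < l.length) :
    ((l.take (r + 1)).drop j).prod = ((l.take r).drop j).prod * l[r] := by
  rw [List.take_succ_eq_append_getElem hr, List.drop_append_of_le_length (by simp; omega)]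
  simp

theorem rseg_succ {M : Type*} [Monoid M] (l : List M) {j r : ℕ} (hj : j ≤ r) (hr : r < l.length) :
    ((l.take (r + 1)).drop j).reverse.prod = l[r] * ((l.take r).drop j).reverse.prod := by
  rw [List.take_succ_eq_append_getElem hr, List.drop_append_of_le_length (by simp; omega)]
  simp

theorem reverse_prod_of_invol {G : Type*} [Group G] (l : List G) (h : ∀ x ∈ l, x⁻¹ = x) :
    l.reverse.prod = l.prod⁻¹ := by
  rw [List.prod_inv_reverse]
  congr 2
  conv_lhs => rw [← List.map_id l]
  exact List.map_congr_left fun x hx => (h x hx).symm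

theorem len_one : len (1 : Equiv.Perm (Fin n)) = 0 := by
  unfold len
  rw [card_eq_zero, filter_eq_empty_iff]
  rintro ⟨p, q⟩ - ⟨h1, h2⟩
  exact absurd h1 h2.asymm

theorem len_prod_le (l : List (Equiv.Perm (Fin n))) (h : ∀ x ∈ l, len x ≤ 1) :
    len l.prod ≤ l.length := by
  induction l with
  | nil => simp [len_one]
  | cons x l ih =>
    rw [List.prod_cons, List.length_cons]
    have h1 := len_mul_le x l.prod
    have h2 := ih fun y hy => h y (List.mem_cons_of_mem _ hy)
    have h3 := h x List.mem_cons_self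
    omega

/-- lower index -/
def lo (ii : Fin m → ℕ) (hii : ∀ r, 1 ≤ ii r ∧ ii r < n) (r : Fin m) : Fin n :=
  ⟨ii r - 1, by have := hii r; omega⟩

/-- upper index -/
def hi (ii : Fin m → ℕ) (hii : ∀ r, 1 ≤ ii r ∧ ii r < n) (r : Fin m) : Fin n :=
  ⟨ii r, (hii r).2⟩

section
variable (ii : Fin m → ℕ) (hii : ∀ r, 1 ≤ ii r ∧ ii r < n)

theorem hi_eq (r : Fin m) : (hi ii hii r : ℕ) = lo ii hii r + 1 := by
  have := hii r
  simp only [hi, lo]; omega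

theorem sperm_eq (r : Fin m) : sperm n (ii r) = Equiv.swap (lo ii hii r) (hi ii hii r) := by
  unfold sperm
  rw [dif_pos (hii r).2]
  rfl

theorem sdot_eq (r : Fin m) :
    (sdot (ii r) : Matrix (Fin n) (Fin n) K) = SS K (lo ii hii r) (hi ii hii r) := by
  ext p q
  have := hii r
  simp only [sdot, SS, Matrix.of_apply, Equiv.swap_apply_def, lo, hi, Fin.ext_iff]
  split_ifs <;> simp_all <;> omega

theorem xmat_eq (r : Fin m) (t : K) :
    (xmat (ii r) t : Matrix (Fin n) (Fin n) K)ᵀ = transvection (hi ii hii r) (lo ii hii r) t := by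
  ext p q
  have := hii r
  simp only [xmat, transpose_apply, Matrix.of_apply, transvection, Matrix.add_apply,
    Matrix.single_apply, Matrix.one_apply, lo, hi, Fin.ext_iff]
  grind

theorem len_sperm_le (hii : ∀ r, 1 ≤ ii r ∧ ii r < n) (r : Fin m) : len (sperm n (ii r)) ≤ 1 := by
  rw [sperm_eq ii hii]
  exact len_swap_le (hi_eq ii hii r)

theorem q_lt (hred : len (sPermList n ii).prod = m) {j : ℕ} (r : Fin m) (hj : j ≤ r) :
    ((((sPermList n ii).take (r : ℕ)).drop j).prod) (lo ii hii r) <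
    ((((sPermList n ii).take (r : ℕ)).drop j).prod) (hi ii hii r) := by
  by_contra hcon
  have hle : ∀ x ∈ sPermList n ii, len x ≤ 1 := by
    intro x hx
    simp only [sPermList, List.mem_ofFn] at hx
    obtain ⟨r, rfl⟩ := hx
    exact len_sperm_le ii hii r
  have hlen : (sPermList n ii).length = m := by simp [sPermList]
  have hne : lo ii hii r ≠ hi ii hii r := by
    intro h; have := hi_eq ii hii r; rw [← h] at this; omega
  set q := (((sPermList n ii).take (r : ℕ)).drop j).prod with hq
  have h1 : q (hi ii hii r) < q (lo ii hii r) :=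
    lt_of_le_of_ne (not_lt.1 hcon) (fun h => hne (q.injective h.symm))
  have h2 := len_mul_swap_lt (hi_eq ii hii r) q h1
  rw [← sperm_eq] at h2
  have hr' : (r : ℕ) < (sPermList n ii).length := by rw [hlen]; exact r.2
  have h3 : q * sperm n (ii r) = (((sPermList n ii).take (r + 1 : ℕ)).drop j).prod := by
    rw [seg_succ _ hj hr']; simp [sPermList, hq]
  have h4 : (sPermList n ii).prod = ((sPermList n ii).take j).prod * (q * sperm n (ii r)) *
      ((sPermList n ii).drop (r + 1)).prod := by
    rw [h3]
    conv_lhs => rw [← List.take_append_drop (r + 1) (sPermList n ii), List.prod_append,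
      ← List.take_append_drop j (List.take (r + 1) (sPermList n ii)), List.prod_append,
      List.take_take, min_eq_left (by omega)]
  have a1 := len_mul_le (((sPermList n ii).take j).prod * (q * sperm n (ii r)))
    ((sPermList n ii).drop (r + 1)).prod
  have a2 := len_mul_le ((sPermList n ii).take j).prod (q * sperm n (ii r))
  have b1 := len_prod_le ((sPermList n ii).take j) fun x hx => hle x (List.mem_of_mem_take hx)
  have b2 := len_prod_le ((sPermList n ii).drop (r + 1)) fun x hx => hle x (List.mem_of_mem_drop hx)
  have b3 := len_prod_le (((sPermList n ii).take (r : ℕ)).drop j)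
    fun x hx => hle x (List.mem_of_mem_take (List.mem_of_mem_drop hx))
  rw [← h4, hred] at a1
  rw [← hq] at b3
  simp only [List.length_take, List.length_drop, hlen] at b1 b2 b3
  have := r.2
  omega

theorem vv_step (v : Equiv.Perm (Fin n)) (r : Fin m) :
    (inJ ii v r → vseq ii v (m - (r + 1)) = vseq ii v (m - r) ∧
      ¬ len (vseq ii v (m - r) * sperm n (ii r)) < len (vseq ii v (m - r))) ∧
    (¬ inJ ii v r → vseq ii v (m - (r + 1)) = vseq ii v (m - r) * sperm n (ii r) ∧
      len (vseq ii v (m - r)) < len (vseq ii v (m - r) * sperm n (ii r))) := by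
  have hr := r.2
  unfold inJ
  obtain ⟨k, hk⟩ : ∃ k, k = m - (r + 1) := ⟨_, rfl⟩
  have e1 : m - (r : ℕ) = k + 1 := by omega
  have e2 : m - (r : ℕ) - 1 = k := by omega
  have hlt : m - k - 1 < m := by omega
  have e3 : (⟨m - k - 1, hlt⟩ : Fin m) = r := by ext; simp; omega
  have ss : sperm n (ii r) * sperm n (ii r) = 1 := by
    unfold sperm; split_ifs <;> simp
  rw [← hk, e2, e1]
  have e4 : vseq ii v (k + 1) = if len (vseq ii v k * sperm n (ii r)) < len (vseq ii v k) then
        vseq ii v k * sperm n (ii r) else vseq ii v k := by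
    rw [vseq, dif_pos hlt, e3]
  by_cases h : len (vseq ii v k * sperm n (ii r)) < len (vseq ii v k)
  · rw [if_pos h] at e4
    have hne : vseq ii v (k + 1) ≠ vseq ii v k := by
      intro h'; rw [← e4, h'] at h; exact lt_irrefl _ h
    refine ⟨fun h' => absurd h' hne, fun _ => ?_⟩
    rw [e4, mul_assoc, ss, mul_one]
    exact ⟨rfl, h⟩
  · rw [if_neg h] at e4
    refine ⟨fun _ => ?_, fun h' => absurd e4 h'⟩
    rw [e4]
    exact ⟨rfl, h⟩

theorem sv_get (v : Equiv.Perm (Fin n)) (r : Fin m) (h : (r : ℕ) < (svPermList ii v).length) :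
    (svPermList ii v)[(r : ℕ)] = if inJ ii v r then 1 else sperm n (ii r) := by
  simp [svPermList]

theorem vv_len (hii : ∀ r, 1 ≤ ii r ∧ ii r < n) (v : Equiv.Perm (Fin n)) (j : ℕ) : ∀ r, j ≤ r → r ≤ m →
    vseq ii v (m - r) = vseq ii v (m - j) * (((svPermList ii v).take r).drop j).prod ∧
    len (vseq ii v (m - j)) + len (((svPermList ii v).take r).drop j).prod ≤
      len (vseq ii v (m - r)) := by
  intro r hj
  induction r, hj using Nat.le_induction with
  | base =>
    intro _
    have : ((svPermList ii v).take j).drop j = [] := by simp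
    simp [this, len_one]
  | succ r hj ih =>
    intro hr
    obtain ⟨ih1, ih2⟩ := ih (by omega)
    have hlen : r < (svPermList ii v).length := by simp [svPermList]; omega
    have hs := vv_step ii v ⟨r, hr⟩
    rw [seg_succ _ hj hlen, sv_get ii v ⟨r, hr⟩ hlen]
    simp only at hs
    by_cases hJ : inJ ii v ⟨r, hr⟩
    · rw [if_pos hJ, mul_one, (hs.1 hJ).1]
      exact ⟨ih1, ih2⟩
    · rw [if_neg hJ, (hs.2 hJ).1, ← mul_assoc, ← ih1]
      refine ⟨rfl, ?_⟩
      have h1 := (hs.2 hJ).2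
      have h2 := len_mul_le (((svPermList ii v).take r).drop j).prod (sperm n (ii ⟨r, hr⟩))
      have h3 := len_sperm_le ii hii ⟨r, hr⟩
      omega

theorem u_lt (v : Equiv.Perm (Fin n)) {j : ℕ} (r : Fin m) (hj : j ≤ r) :
    ((((svPermList ii v).take (r : ℕ)).drop j).prod) (lo ii hii r) <
    ((((svPermList ii v).take (r : ℕ)).drop j).prod) (hi ii hii r) := by
  by_contra hcon
  have hne : lo ii hii r ≠ hi ii hii r := by
    intro h; have := hi_eq ii hii r; rw [← h] at this; omega
  obtain ⟨h1, h2⟩ := vv_len ii hii v j r hj r.2.le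
  set q := (((svPermList ii v).take (r : ℕ)).drop j).prod with hq
  have h3 : q (hi ii hii r) < q (lo ii hii r) :=
    lt_of_le_of_ne (not_lt.1 hcon) (fun h => hne (q.injective h.symm))
  have h4 := len_mul_swap_lt (hi_eq ii hii r) q h3
  rw [← sperm_eq] at h4
  have h5 := len_mul_le (vseq ii v (m - j)) (q * sperm n (ii r))
  rw [← mul_assoc, ← h1] at h5
  have hs := vv_step ii v r
  by_cases hJ : inJ ii v r
  · have := (hs.1 hJ).2
    omega
  · have := (hs.2 hJ).2
    omega

theorem sperm_inv (i : ℕ) : (sperm n i)⁻¹ = sperm n i := by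
  unfold sperm; split_ifs <;> simp

/-- the moving sets -/
def mset (l : List (Equiv.Perm (Fin n))) (k j r : ℕ) : Finset (Fin n) :=
  (univ.filter fun x : Fin n => (x : ℕ) < k).image ⇑(((l.take r).drop j).reverse.prod)

theorem mem_mset {l : List (Equiv.Perm (Fin n))} (hl : ∀ x ∈ l, x⁻¹ = x) (k j r : ℕ) (x : Fin n) :
    x ∈ mset l k j r ↔ (((l.take r).drop j).prod x : ℕ) < k := by
  unfold mset
  rw [reverse_prod_of_invol _ fun y hy => hl y (List.mem_of_mem_take (List.mem_of_mem_drop hy))]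
  simp only [mem_image, mem_filter, mem_univ, true_and]
  constructor
  · rintro ⟨y, hy, rfl⟩; simpa using hy
  · intro h; exact ⟨_, h, by simp⟩

theorem mset_succ (l : List (Equiv.Perm (Fin n))) (k : ℕ) {j r : ℕ} (hj : j ≤ r)
    (hr : r < l.length) : mset l k j (r + 1) = (mset l k j r).image l[r] := by
  unfold mset
  rw [rseg_succ l hj hr, image_image]
  rfl

/-- the factors -/
def FF (n : ℕ) (ii : Fin m → ℕ) (t : Fin m → K) (j r : Fin m) : K :=
  t r ^
            (-((if ∃ x : Fin n, (x : ℕ) + 1 = ii r ∧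
                   (((((sPermList n ii).take (r : ℕ)).drop (j : ℕ)).prod) x : ℕ) < ii j
                then (1 : ℤ) else 0)
              - (if ∃ x : Fin n, (x : ℕ) = ii r ∧
                   (((((sPermList n ii).take (r : ℕ)).drop (j : ℕ)).prod) x : ℕ) < ii j
                then (1 : ℤ) else 0)))

theorem main_ind (hii : ∀ r, 1 ≤ ii r ∧ ii r < n) (hred : len (sPermList n ii).prod = m) (v : Equiv.Perm (Fin n))
    (t : Fin m → K) (ht : ∀ r, inJ ii v r → t r ≠ 0) : ∀ r : ℕ, r ≤ m →
    ∃ a L : Matrix (Fin n) (Fin n) K,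
      (((mrgList ii v t).take r).prod)ᵀ * ((sdotList n ii).take r).prod = a * L ∧
      IsN a ∧ LowInv ((sPermList n ii).take r).prod L ∧
      ∀ j : Fin m, (j : ℕ) ≤ r →
        minor a (mset (svPermList ii v) (ii j) j r) (mset (sPermList n ii) (ii j) j r) =
        ∏ r' ∈ univ.filter (fun r' : Fin m => inJ ii v r' ∧ j ≤ r' ∧ (r' : ℕ) < r),
          FF n ii t j r' := by
  have base : ∀ (a : Matrix (Fin n) (Fin n) K), IsN a → ∀ j : Fin m,
      minor a (mset (svPermList ii v) (ii j) j j) (mset (sPermList n ii) (ii j) j j) =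
        ∏ r' ∈ univ.filter (fun r' : Fin m => inJ ii v r' ∧ j ≤ r' ∧ (r' : ℕ) < j),
          FF n ii t j r' := by
    intro a ha j
    have e1 : mset (svPermList ii v) (ii j) j j = mset (sPermList n ii) (ii j) j j := by
      have h1 : ((svPermList ii v).take j).drop j = [] := by simp
      have h2 : ((sPermList n ii).take j).drop j = [] := by simp
      unfold mset
      rw [h1, h2]
    rw [e1, minor_self_of_isN ha]
    symm
    apply prod_eq_one
    intro r' h
    simp only [mem_filter, mem_univ, true_and, Fin.le_def] at h
    omega
  have hinvs : ∀ x ∈ sPermList n ii, x⁻¹ = x := by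
    intro x hx
    simp only [sPermList, List.mem_ofFn] at hx
    obtain ⟨r, rfl⟩ := hx
    exact sperm_inv _
  have hinvv : ∀ x ∈ svPermList ii v, x⁻¹ = x := by
    intro x hx
    simp only [svPermList, List.mem_ofFn] at hx
    obtain ⟨r, rfl⟩ := hx
    split_ifs
    · simp
    · exact sperm_inv _
  intro r
  induction r with
  | zero =>
    intro _
    refine ⟨1, 1, by simp, ⟨by simp, fun i j h => by simp [h.ne']⟩, ?_, ?_⟩
    · intro p q h
      by_cases hpq : p = q
      · subst hpq; simp
      · exact absurd (one_apply_ne hpq) h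
    · intro j hj
      have := base 1 ⟨by simp, fun i j h => by simp [h.ne']⟩ j
      have hj0 : (j : ℕ) = 0 := Nat.le_zero.1 hj
      rw [hj0] at this ⊢
      exact this
  | succ r ih =>
    intro hr
    obtain ⟨a, L, hG, ha, hL, hmin⟩ := ih (by omega)
    set R : Fin m := ⟨r, hr⟩ with hR
    have hi' := hi_eq ii hii R
    have hw := q_lt ii hii hred (j := 0) R (Nat.zero_le _)
    rw [List.drop_zero] at hw
    have l1 : r < (mrgList ii v t).length := by simp [mrgList]; omega
    have l2 : r < (sdotList (K := K) n ii).length := by simp [sdotList]; omega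
    have l3 : r < (sPermList n ii).length := by simp [sPermList]; omega
    have l4 : r < (svPermList ii v).length := by simp [svPermList]; omega
    have g1 := seg_succ (mrgList ii v t) (Nat.zero_le r) l1
    have g2 := seg_succ (sdotList (K := K) n ii) (Nat.zero_le r) l2
    have g3 := seg_succ (sPermList n ii) (Nat.zero_le r) l3
    have s1 : (mrgList ii v t)[r] = if inJ ii v R then xmat (ii R) (t R) else sdot (ii R) := by
      simp [mrgList, hR]
    have s2 : (sdotList (K := K) n ii)[r] = SS K (lo ii hii R) (hi ii hii R) := by
      rw [← sdot_eq]; simp [sdotList, hR]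
    have s3 : (sPermList n ii)[r] = Equiv.swap (lo ii hii R) (hi ii hii R) := by
      rw [← sperm_eq]; simp [sPermList, hR]
    have s4 : (svPermList ii v)[r] = if inJ ii v R then 1 else
        Equiv.swap (lo ii hii R) (hi ii hii R) := by
      rw [← sperm_eq]; simp [svPermList, hR]
    simp only [List.drop_zero] at g1 g2 g3
    have hW : ∀ j : Fin m, (j : ℕ) ≤ r → (hi ii hii R ∈ mset (sPermList n ii) (ii j) j r →
        lo ii hii R ∈ mset (sPermList n ii) (ii j) j r) := by
      intro j hj
      rw [mem_mset hinvs, mem_mset hinvs]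
      have := q_lt ii hii hred R hj
      rw [Fin.lt_def] at this
      exact fun h => this.trans h
    have hV : ∀ j : Fin m, (j : ℕ) ≤ r → (hi ii hii R ∈ mset (svPermList ii v) (ii j) j r →
        lo ii hii R ∈ mset (svPermList ii v) (ii j) j r) := by
      intro j hj
      rw [mem_mset hinvv, mem_mset hinvv]
      have := u_lt ii hii v R hj
      rw [Fin.lt_def] at this
      exact fun h => this.trans h
    by_cases hJ : inJ ii v R
    · rw [if_pos hJ] at s1 s4
      obtain ⟨a', L', h1, h2, h3, h4⟩ := step_X hi' hw ha hL (ht R hJ)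
      refine ⟨a', L', ?_, h2, ?_, ?_⟩
      · rw [g1, g2, transpose_mul, s1, s2, xmat_eq ii hii, ← h1, ← hG]
        simp only [mul_assoc]
      · rw [g3, s3]; exact h3
      · intro j hj
        rcases Nat.eq_or_lt_of_le hj with hj | hj
        · rw [← hj]; exact base a' h2 j
        · have hj' : (j : ℕ) ≤ r := by omega
          rw [mset_succ _ _ hj' l3, mset_succ _ _ hj' l4, s3, s4, Equiv.Perm.coe_one, image_id,
            h4 _ _ (hV j hj') (hW j hj'), hmin j hj']
          have ef : univ.filter (fun r' : Fin m => inJ ii v r' ∧ j ≤ r' ∧ (r' : ℕ) < r + 1) =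
              insert R (univ.filter (fun r' : Fin m => inJ ii v r' ∧ j ≤ r' ∧ (r' : ℕ) < r)) := by
            ext x
            simp only [mem_filter, mem_univ, true_and, mem_insert]
            constructor
            · rintro ⟨c1, c2, c3⟩
              by_cases hx : x = R
              · exact Or.inl hx
              · right
                refine ⟨c1, c2, ?_⟩
                have : (x : ℕ) ≠ r := fun h => hx (Fin.ext h)
                omega
            · rintro (rfl | ⟨c1, c2, c3⟩)
              · exact ⟨hJ, hj', Nat.lt_succ_self r⟩
              · exact ⟨c1, c2, by omega⟩
          rw [ef, prod_insert (by simp [hR])]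
          congr 1
          unfold FF
          have x0 : (∃ x : Fin n, (x : ℕ) + 1 = ii R ∧
              (((((sPermList n ii).take (R : ℕ)).drop (j : ℕ)).prod) x : ℕ) < ii j) ↔
              lo ii hii R ∈ mset (sPermList n ii) (ii j) j r := by
            rw [mem_mset hinvs]
            constructor
            · rintro ⟨x, hx, hx'⟩
              have : x = lo ii hii R := by ext; simp only [lo]; omega
              rwa [this] at hx'
            · intro h
              exact ⟨_, by simp only [lo]; have := hii R; omega, h⟩
          have x1 : (∃ x : Fin n, (x : ℕ) = ii R ∧
              (((((sPermList n ii).take (R : ℕ)).drop (j : ℕ)).prod) x : ℕ) < ii j) ↔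
              hi ii hii R ∈ mset (sPermList n ii) (ii j) j r := by
            rw [mem_mset hinvs]
            constructor
            · rintro ⟨x, hx, hx'⟩
              have : x = hi ii hii R := by ext; simp only [hi]; omega
              rwa [this] at hx'
            · intro h
              exact ⟨_, by simp only [hi], h⟩
          simp only [x0, x1]
    · rw [if_neg hJ] at s1 s4
      obtain ⟨a', L', h1, h2, h3, h4⟩ := step_S hi' hw ha hL
      refine ⟨a', L', ?_, h2, ?_, ?_⟩
      · rw [g1, g2, transpose_mul, s1, s2, sdot_eq ii hii, ← h1, ← hG]
        simp only [mul_assoc]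
      · rw [g3, s3]; exact h3
      · intro j hj
        rcases Nat.eq_or_lt_of_le hj with hj | hj
        · rw [← hj]; exact base a' h2 j
        · have hj' : (j : ℕ) ≤ r := by omega
          rw [mset_succ _ _ hj' l3, mset_succ _ _ hj' l4, s3, s4,
            h4 _ _ (hV j hj') (hW j hj'), hmin j hj']
          congr 1
          ext x
          simp only [mem_filter, mem_univ, true_and]
          constructor
          · rintro ⟨c1, c2, c3⟩
            exact ⟨c1, c2, by omega⟩
          · rintro ⟨c1, c2, c3⟩
            refine ⟨c1, c2, ?_⟩
            have : (x : ℕ) ≠ r := fun h => hJ ((Fin.ext h : x = R) ▸ c1)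
            omega

theorem det_SS {i₀ i₁ : Fin n} (h : i₀ ≠ i₁) : (SS K i₀ i₁).det = 1 := by
  rw [← det_transpose, SST_eq h, det_mul, det_mul, det_transvection_of_ne _ _ h,
    det_transvection_of_ne _ _ h.symm]
  simp

theorem det_list_prod (l : List (Matrix (Fin n) (Fin n) K)) (h : ∀ x ∈ l, x.det = 1) :
    l.prod.det = 1 := by
  induction l with
  | nil => simp
  | cons x l ih =>
    rw [List.prod_cons, det_mul, h x List.mem_cons_self,
      ih fun y hy => h y (List.mem_cons_of_mem _ hy), one_mul]

theorem det_G (hii : ∀ r, 1 ≤ ii r ∧ ii r < n) (v : Equiv.Perm (Fin n)) (t : Fin m → K) :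
    ((mrg ii v t)ᵀ * wMR n ii).det = 1 := by
  have hne : ∀ r, lo ii hii r ≠ hi ii hii r := by
    intro r h; have := hi_eq ii hii r; rw [← h] at this; omega
  have hs : ∀ r, (sdot (ii r) : Matrix (Fin n) (Fin n) K).det = 1 := by
    intro r; rw [sdot_eq ii hii, det_SS (hne r)]
  rw [det_mul, det_transpose, mrg, wMR, det_list_prod, det_list_prod, one_mul]
  · intro x hx
    simp only [sdotList, List.mem_ofFn] at hx
    obtain ⟨r, rfl⟩ := hx
    exact hs r
  · intro x hx
    simp only [mrgList, List.mem_ofFn] at hx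
    obtain ⟨r, rfl⟩ := hx
    split_ifs
    · rw [← det_transpose, xmat_eq ii hii, det_transvection_of_ne _ _ (hne r).symm]
    · exact hs r

end

theorem IsN.upper {a : Matrix (Fin n) (Fin n) K} (ha : IsN a) : a.IsUpperTriangular :=
  fun _ _ h => ha.2 _ _ h

theorem IsN.det_eq {a : Matrix (Fin n) (Fin n) K} (ha : IsN a) : a.det = 1 := by
  rw [det_of_isUpperTriangular ha.upper]
  simp [ha.1]

theorem det_lower {L : Matrix (Fin n) (Fin n) K} (hL : ∀ i j, i < j → L i j = 0) :
    L.det = ∏ i, L i i :=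
  det_of_isLowerTriangular L fun _ _ h => hL _ _ h

theorem isN_unique {a a' L L' : Matrix (Fin n) (Fin n) K} (ha : IsN a) (ha' : IsN a')
    (hL : ∀ i j, i < j → L i j = 0) (hL' : ∀ i j, i < j → L' i j = 0)
    (hd : L.det = 1) (h : a * L = a' * L') : a = a' := by
  have hau : IsUnit a'.det := by rw [ha'.det_eq]; exact isUnit_one
  have hLu : IsUnit L.det := by rw [hd]; exact isUnit_one
  let _ : Invertible a' := a'.invertibleOfIsUnitDet hau
  let _ : Invertible L := L.invertibleOfIsUnitDet hLu
  have hX : a'⁻¹ * a = L' * L⁻¹ := by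
    have : a = a' * L' * L⁻¹ := by rw [← h, mul_assoc, mul_nonsing_inv _ hLu, mul_one]
    rw [this, mul_assoc a', ← mul_assoc, nonsing_inv_mul _ hau, one_mul]
  have h1 : BlockTriangular (a'⁻¹ * a) id :=
    (blockTriangular_inv_of_blockTriangular (b := id) (M := a') ha'.upper).mul
      (ha.upper : BlockTriangular a id)
  have hLb : BlockTriangular L OrderDual.toDual := fun i j h => hL i j h
  have hLb' : BlockTriangular L' OrderDual.toDual := fun i j h => hL' i j h
  have h2 : BlockTriangular (a'⁻¹ * a) OrderDual.toDual := by
    rw [hX]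
    exact hLb'.mul (blockTriangular_inv_of_blockTriangular hLb)
  have h3 : a = a' * (a'⁻¹ * a) := by rw [← mul_assoc, mul_nonsing_inv _ hau, one_mul]
  set X := a'⁻¹ * a
  have hdiag : X = diagonal fun i => X i i := by
    ext i j
    rcases lt_trichotomy i j with h | h | h
    · rw [diagonal_apply_ne _ h.ne]; exact h2 h
    · subst h; simp
    · rw [diagonal_apply_ne _ h.ne']; exact h1 h
  have hone : ∀ i, X i i = 1 := by
    intro i
    have := congrFun (congrFun h3 i) i
    rw [hdiag, mul_diagonal, ha.1, ha'.1, one_mul] at this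
    exact this.symm
  rw [h3, hdiag]
  simp [hone]

/-- right twist Chamber Ansatz, inverse form (Theorem 2.12, eq. (2.13), type A).
Here `j : Fin m` is the 0-based version of the 1-based index `j+1`; the 1-based condition
`q_{j,r}(i_r) ≤ i_j` is expressed as `∃ x, (x:ℕ)+1 = i_r ∧ (q_{j,r} x : ℕ) < i_j`. -/
theorem statement_16 {n m : ℕ} (hn : 1 ≤ n) (ii : Fin m → ℕ)
    (hii : ∀ r, 1 ≤ ii r ∧ ii r < n)
    (w : Equiv.Perm (Fin n)) (hw : w = (sPermList n ii).prod) (hred : len w = m)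
    (v : Equiv.Perm (Fin n)) (hv0 : vseq ii v m = 1)
    (t : Fin m → ℂ) (ht : ∀ r, inJ ii v r → t r ≠ 0) :
    (∃ a b c, UDL ((mrg ii v t)ᵀ * wMR n ii) a b c) ∧
    ∀ a b c, UDL ((mrg ii v t)ᵀ * wMR n ii) a b c →
      ∀ j : Fin m,
        minor a
          ((univ.filter fun x : Fin n => (x : ℕ) < ii j).image
            ⇑(((svPermList ii v).drop (j : ℕ)).reverse.prod))
          ((univ.filter fun x : Fin n => (x : ℕ) < ii j).image
            ⇑(((sPermList n ii).drop (j : ℕ)).reverse.prod))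
        =
        ∏ r ∈ univ.filter (fun r : Fin m => inJ ii v r ∧ j ≤ r),
          t r ^
            (-((if ∃ x : Fin n, (x : ℕ) + 1 = ii r ∧
                   (((((sPermList n ii).take (r : ℕ)).drop (j : ℕ)).prod) x : ℕ) < ii j
                then (1 : ℤ) else 0)
              - (if ∃ x : Fin n, (x : ℕ) = ii r ∧
                   (((((sPermList n ii).take (r : ℕ)).drop (j : ℕ)).prod) x : ℕ) < ii j
                then (1 : ℤ) else 0))) := by
  obtain ⟨a, L, hG, ha, hL, hmin⟩ := main_ind ii hii (by rw [← hw]; exact hred) v t ht m le_rfl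
  have f1 : (mrgList ii v t).take m = mrgList ii v t := List.take_of_length_le (by simp [mrgList])
  have f2 : (sdotList (K := ℂ) n ii).take m = sdotList n ii :=
    List.take_of_length_le (by simp [sdotList])
  have f3 : (sPermList n ii).take m = sPermList n ii := List.take_of_length_le (by simp [sPermList])
  have f4 : (svPermList ii v).take m = svPermList ii v :=
    List.take_of_length_le (by simp [svPermList])
  rw [f1, f2] at hG
  have hG' : (mrg ii v t)ᵀ * wMR n ii = a * L := hG
  have hLl : ∀ i j, i < j → L i j = 0 := by
    intro i j hij
    by_contra h
    exact absurd hij (not_lt.2 (hL i j h).1)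
  have hLd : L.det = 1 := by
    have := det_G ii hii v t
    rwa [hG', det_mul, ha.det_eq, one_mul] at this
  have hprod : ∏ i, L i i = 1 := by rw [← det_lower hLl, hLd]
  have hnz : ∀ i, L i i ≠ 0 := by
    intro i h
    rw [Finset.prod_eq_zero (f := fun i => L i i) (mem_univ i) h] at hprod
    exact zero_ne_one hprod
  constructor
  · refine ⟨a, diagonal fun i => L i i, diagonal (fun i => (L i i)⁻¹) * L, ha, ⟨?_, ?_⟩, ⟨?_, ?_⟩, ?_⟩
    · rw [det_diagonal, hprod]
    · intro i j hij
      exact diagonal_apply_ne _ hij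
    · intro i
      rw [diagonal_mul, inv_mul_cancel₀ (hnz i)]
    · intro i j hij
      rw [diagonal_mul, hLl i j hij, mul_zero]
    · have : (diagonal fun i => L i i) * diagonal (fun i => (L i i)⁻¹) = 1 := by
        rw [diagonal_mul_diagonal, ← diagonal_one]
        congr 1
        ext i
        exact mul_inv_cancel₀ (hnz i)
      rw [hG', mul_assoc, ← mul_assoc (diagonal fun i => L i i), this, one_mul]
  · rintro a' b c ⟨h1, h2, h3, h4⟩ j
    have haa : a = a' := by
      refine isN_unique (L := L) (L' := b * c) ha h1 hLl ?_ hLd ?_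
      · intro i k hik
        rw [Matrix.mul_apply]
        apply Finset.sum_eq_zero
        intro x _
        by_cases hx : i = x
        · subst hx; rw [h3.2 _ _ hik, mul_zero]
        · rw [h2.2 _ _ hx, zero_mul]
      · rw [← hG', h4, mul_assoc]
    subst haa
    have := hmin j j.2.le
    unfold mset at this
    rw [f3, f4] at this
    rw [this]
    have ef : univ.filter (fun r' : Fin m => inJ ii v r' ∧ j ≤ r' ∧ (r' : ℕ) < m) =
        univ.filter (fun r' : Fin m => inJ ii v r' ∧ j ≤ r') := by
      ext x
      simp
    rw [ef]
    rfl

end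
end Paper
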